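/- Let R be a commutative ring and define the Sergeev map ρ : (x,y,z) ↦ (z, xz − y, x). For 1 ≤ k ≤ 4 let R(k) : R⁶ → R⁶ apply ρ to the entries (t_k, t_{k+1}, t_{k+2}) of a 6-tuple t, and for 1 ≤ k ≤ 5 let L(k) swap entries t_k and t_{k+1}. Then for all a₁, …, a₆ ∈ R the compositions R(1)∘R(3)∘L(5)∘L(2)∘R(3)∘R(1)∘L(3) and L(3)∘R(4)∘R(2)∘L(4)∘L(1)∘R(2)∘R(4), applied to the tuple (a₆, a₅, a₄, a₃, a₂, a₁), give the same result, namely (a₁, a₁a₃ − a₂, a₃, a₁a₃a₆ − a₁a₅ − a₂a₆ + a₄, a₃a₆ − a₅, a₆). -/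

import Mathlib

/-- The Sergeev map `ρ(x,y,z) = (z, xz − y, x)`. -/
def sergeevR {R : Type*} [CommRing R] (p : R × R × R) : R × R × R :=
  (p.2.2, p.1 * p.2.2 - p.2.1, p.1)

/-- `R(k)`: apply `ρ` to positions `k, k+1, k+2` (0-based `k`) of a 6-tuple. -/
def Rmv {R : Type*} [CommRing R] (k : Fin 6) (t : Fin 6 → R) : Fin 6 → R :=
  fun m =>
    if m = k then (sergeevR (t k, t (k + 1), t (k + 2))).1
    else if m = k + 1 then (sergeevR (t k, t (k + 1), t (k + 2))).2.1
    else if m = k + 2 then (sergeevR (t k, t (k + 1), t (k + 2))).2.2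
    else t m

/-- `L(k)`: swap the entries in positions `k` and `k+1` (0-based `k`). -/
def Lmv {R : Type*} [CommRing R] (k : Fin 6) (t : Fin 6 → R) : Fin 6 → R :=
  fun m => if m = k then t (k + 1) else if m = k + 1 then t k else t m

section Evaluation

variable {R : Type*} [CommRing R] (x₀ x₁ x₂ x₃ x₄ x₅ : R)

lemma Rmv_0_vec : Rmv 0 ![x₀, x₁, x₂, x₃, x₄, x₅] = ![x₂, x₀ * x₂ - x₁, x₀, x₃, x₄, x₅] := by
  ext m; fin_cases m <;> rfl

lemma Rmv_1_vec : Rmv 1 ![x₀, x₁, x₂, x₃, x₄, x₅] = ![x₀, x₃, x₁ * x₃ - x₂, x₁, x₄, x₅] := by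
  ext m; fin_cases m <;> rfl

lemma Rmv_2_vec : Rmv 2 ![x₀, x₁, x₂, x₃, x₄, x₅] = ![x₀, x₁, x₄, x₂ * x₄ - x₃, x₂, x₅] := by
  ext m; fin_cases m <;> rfl

lemma Rmv_3_vec : Rmv 3 ![x₀, x₁, x₂, x₃, x₄, x₅] = ![x₀, x₁, x₂, x₅, x₃ * x₅ - x₄, x₃] := by
  ext m; fin_cases m <;> rfl

lemma Lmv_0_vec : Lmv 0 ![x₀, x₁, x₂, x₃, x₄, x₅] = ![x₁, x₀, x₂, x₃, x₄, x₅] := by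
  ext m; fin_cases m <;> rfl

lemma Lmv_1_vec : Lmv 1 ![x₀, x₁, x₂, x₃, x₄, x₅] = ![x₀, x₂, x₁, x₃, x₄, x₅] := by
  ext m; fin_cases m <;> rfl

lemma Lmv_2_vec : Lmv 2 ![x₀, x₁, x₂, x₃, x₄, x₅] = ![x₀, x₁, x₃, x₂, x₄, x₅] := by
  ext m; fin_cases m <;> rfl

lemma Lmv_3_vec : Lmv 3 ![x₀, x₁, x₂, x₃, x₄, x₅] = ![x₀, x₁, x₂, x₄, x₃, x₅] := by
  ext m; fin_cases m <;> rfl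

lemma Lmv_4_vec : Lmv 4 ![x₀, x₁, x₂, x₃, x₄, x₅] = ![x₀, x₁, x₂, x₃, x₅, x₄] := by
  ext m; fin_cases m <;> rfl

end Evaluation

/-- The tetrahedron (sonnet) equation for the Sergeev (α) flip: the compositions
`R(1)∘R(3)∘L(5)∘L(2)∘R(3)∘R(1)∘L(3)` and `L(3)∘R(4)∘R(2)∘L(4)∘L(1)∘R(2)∘R(4)` applied to
`(a₆,a₅,a₄,a₃,a₂,a₁)` give the same result
`(a₁, a₁a₃−a₂, a₃, a₁a₃a₆−a₁a₅−a₂a₆+a₄, a₃a₆−a₅, a₆)`.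
(Moves are written with 0-based positions.) -/
theorem sonnet_sergeev_flip {R : Type*} [CommRing R] (a₁ a₂ a₃ a₄ a₅ a₆ : R) :
    Rmv 0 (Rmv 2 (Lmv 4 (Lmv 1 (Rmv 2 (Rmv 0 (Lmv 2 ![a₆, a₅, a₄, a₃, a₂, a₁])))))) =
        ![a₁, a₁ * a₃ - a₂, a₃, a₁ * a₃ * a₆ - a₁ * a₅ - a₂ * a₆ + a₄,
          a₃ * a₆ - a₅, a₆] ∧
    Lmv 2 (Rmv 3 (Rmv 1 (Lmv 3 (Lmv 0 (Rmv 1 (Rmv 3 ![a₆, a₅, a₄, a₃, a₂, a₁])))))) =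
        ![a₁, a₁ * a₃ - a₂, a₃, a₁ * a₃ * a₆ - a₁ * a₅ - a₂ * a₆ + a₄,
          a₃ * a₆ - a₅, a₆] := by
  constructor
  · rw [Lmv_2_vec, Rmv_0_vec, Rmv_2_vec, Lmv_1_vec, Lmv_4_vec, Rmv_2_vec, Rmv_0_vec]
    congrm ![?_, ?_, ?_, ?_, ?_, ?_] <;> ring
  · rw [Rmv_3_vec, Rmv_1_vec, Lmv_0_vec, Lmv_3_vec, Rmv_1_vec, Rmv_3_vec, Lmv_2_vec]
    congrm ![?_, ?_, ?_, ?_, ?_, ?_] <;> ring
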